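/- Suppose G contains at least one subset of edges which is either an even cycle without an even-chord, or an edge-disjoint union of two odd cycles with at most one vertex in common without an even-chord, and let 2d be the greatest cardinality of such a subset. Then the maximal generating degree of the Eulerian ideal satisfies d(I(G)) ≤ d; moreover, if G is bipartite, then d(I(G)) = d. -/

import Mathlib

open MvPolynomial Finset

variable {n : ℕ}

/-- The monomial `x_i * x_j` attached to an edge `{i,j}`. -/
noncomputable def edgeMono (K : Type*) [Field K] (e : Sym2 (Fin n)) :
    MvPolynomial (Fin n) K :=
  Sym2.lift ⟨fun i j => X i * X j, fun _ _ => mul_comm _ _⟩ e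

/-- The map `φ : K[E_G] → K[x_1,…,x_n]`, `t_e ↦ x_i x_j` for `e = {i,j}`. -/
noncomputable def phiG (K : Type*) [Field K] (G : SimpleGraph (Fin n)) :
    MvPolynomial G.edgeSet K →ₐ[K] MvPolynomial (Fin n) K :=
  aeval (fun e => edgeMono K e.1)

/-- The Eulerian ideal `I(G) = φ⁻¹(x_i² - x_j² : i, j)`. -/
noncomputable def eulerianIdeal (K : Type*) [Field K] (G : SimpleGraph (Fin n)) :
    Ideal (MvPolynomial G.edgeSet K) :=
  Ideal.comap (phiG K G) (Ideal.span {f | ∃ i j : Fin n, f = X i ^ 2 - X j ^ 2})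

/-- `deg_J(i)`: the number of edges of `J` containing the vertex `i`. -/
def degIn (G : SimpleGraph (Fin n)) (J : Finset G.edgeSet) (i : Fin n) : ℕ :=
  (J.filter fun e => i ∈ e.val).card

/-- A set of edges is Eulerian if every vertex has even degree in it. -/
def IsEulerianSet (G : SimpleGraph (Fin n)) (C : Finset G.edgeSet) : Prop :=
  ∀ i : Fin n, Even (degIn G C i)

/-- `J` is a `T`-join. -/
def IsTJoin (G : SimpleGraph (Fin n)) (T : Finset (Fin n)) (J : Finset G.edgeSet) : Prop :=
  ∀ i : Fin n, i ∈ T ↔ Odd (degIn G J i)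

/-- `J` is a `(T,p)`-join. -/
def IsTPJoin (G : SimpleGraph (Fin n)) (T : Finset (Fin n)) (p : ZMod 2)
    (J : Finset G.edgeSet) : Prop :=
  IsTJoin G T J ∧ (J.card : ZMod 2) = p

/-- `(T,p) ∈ 𝒯_G`: there exists a `(T,p)`-join. -/
def JoinExists (G : SimpleGraph (Fin n)) (T : Finset (Fin n)) (p : ZMod 2) : Prop :=
  ∃ J : Finset G.edgeSet, IsTPJoin G T p J

/-- `J ∈ 𝒥(T,p)`: `J` is a `(T,p)`-join of minimum cardinality. -/
def IsMinJoin (G : SimpleGraph (Fin n)) (T : Finset (Fin n)) (p : ZMod 2)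
    (J : Finset G.edgeSet) : Prop :=
  IsTPJoin G T p J ∧ ∀ J' : Finset G.edgeSet, IsTPJoin G T p J' → J.card ≤ J'.card

/-- The equivalence relation `∼` on minimum cardinality `(T,p)`-joins. -/
def JoinEquiv (G : SimpleGraph (Fin n)) (T : Finset (Fin n)) (p : ZMod 2)
    (J K : Finset G.edgeSet) : Prop :=
  ∃ (r : ℕ) (L : ℕ → Finset G.edgeSet), L 0 = J ∧ L r = K ∧
    (∀ i ≤ r, IsMinJoin G T p (L i)) ∧ ∀ i < r, (L i ∩ L (i + 1)).Nonempty

/-- `(T,p) ∈ 𝒯_G*`: there are two nonequivalent minimum cardinality `(T,p)`-joins. -/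
def TGstar (G : SimpleGraph (Fin n)) (T : Finset (Fin n)) (p : ZMod 2) : Prop :=
  ∃ J K : Finset G.edgeSet, IsMinJoin G T p J ∧ IsMinJoin G T p K ∧ ¬ JoinEquiv G T p J K

/-- `t_J`, the product of the variables indexed by the edges of `J`. -/
noncomputable def tMon (K : Type*) [Field K] (G : SimpleGraph (Fin n))
    (J : Finset G.edgeSet) : MvPolynomial G.edgeSet K :=
  ∏ e ∈ J, X e

/-- The vertex set of a set of edges. -/
def edgeVerts (G : SimpleGraph (Fin n)) (C : Finset G.edgeSet) : Finset (Fin n) :=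
  Finset.univ.filter fun i => ∃ e ∈ C, i ∈ e.val

/-- `C` is the edge set of a cycle of `G`. -/
def IsCycleSet (G : SimpleGraph (Fin n)) (C : Finset G.edgeSet) : Prop :=
  ∃ (v : Fin n) (w : G.Walk v v), w.IsCycle ∧
    C.image (fun e => e.val) = w.edges.toFinset

/-- A chord of a cycle `C`: an edge of `G` joining two nonadjacent vertices of `C`. -/
def IsChord (G : SimpleGraph (Fin n)) (C : Finset G.edgeSet) (l : G.edgeSet) : Prop :=
  l ∉ C ∧ ∀ i ∈ l.val, i ∈ edgeVerts G C

/-- An even-chord of an even cardinality Eulerian set `C`. -/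
def IsEvenChord (G : SimpleGraph (Fin n)) (C : Finset G.edgeSet) (l : G.edgeSet) : Prop :=
  l ∉ C ∧ ∃ C₁ C₂ : Finset G.edgeSet,
    IsEulerianSet G C₁ ∧ Even C₁.card ∧ IsEulerianSet G C₂ ∧ Even C₂.card ∧
    C₁ ∩ C₂ = {l} ∧ C = symmDiff C₁ C₂

/-- `S` is a minimal homogeneous generating set of the ideal `I`. -/
def IsMinimalHomGenSet {σ K : Type*} [Field K] (S : Set (MvPolynomial σ K))
    (I : Ideal (MvPolynomial σ K)) : Prop :=
  (∀ f ∈ S, ∃ d : ℕ, f.IsHomogeneous d) ∧ Ideal.span S = I ∧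
    ∀ f ∈ S, Ideal.span (S \ {f}) ≠ I


/-- A subset of edges which is either an even cycle without an even-chord, or an
edge-disjoint union of two odd cycles with at most one vertex in common without an
even-chord. -/
def SpecialSet {n : ℕ} (G : SimpleGraph (Fin n)) (C : Finset G.edgeSet) : Prop :=
  ((IsCycleSet G C ∧ Even C.card) ∨
    (∃ C₁ C₂ : Finset G.edgeSet,
      IsCycleSet G C₁ ∧ Odd C₁.card ∧ IsCycleSet G C₂ ∧ Odd C₂.card ∧
      Disjoint C₁ C₂ ∧ (edgeVerts G C₁ ∩ edgeVerts G C₂).card ≤ 1 ∧ C = C₁ ∪ C₂)) ∧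
  ¬ ∃ l : G.edgeSet, IsEvenChord G C l

/-- The degrees at the vertices of the multigraph with edge multiplicities `a`. -/
noncomputable def vdeg (G : SimpleGraph (Fin n)) : (G.edgeSet →₀ ℕ) →ₗ[ℕ] (Fin n → ℕ) :=
  Finsupp.linearCombination ℕ fun e i => if i ∈ e.val then 1 else 0

/-- Two edge monomials have the same degree and the same parities at the vertices. -/
def SameClass (G : SimpleGraph (Fin n)) (a b : G.edgeSet →₀ ℕ) : Prop :=
  a.degree = b.degree ∧ ∀ i, (vdeg G a i : ZMod 2) = vdeg G b i

section Binomials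

variable (K : Type*) [Field K] {G : SimpleGraph (Fin n)}

lemma vdeg_single (e : G.edgeSet) (m : ℕ) (i : Fin n) :
    vdeg G (Finsupp.single e m) i = if i ∈ e.val then m else 0 := by
  simp [vdeg, Finsupp.linearCombination_single]

lemma SameClass.symm {a b : G.edgeSet →₀ ℕ} (h : SameClass G a b) : SameClass G b a :=
  ⟨h.1.symm, fun i => (h.2 i).symm⟩

lemma SameClass.trans {a b c : G.edgeSet →₀ ℕ} (h : SameClass G a b) (h' : SameClass G b c) :
    SameClass G a c :=
  ⟨h.1.trans h'.1, fun i => (h.2 i).trans (h'.2 i)⟩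

lemma sameClass_add_iff {a b c : G.edgeSet →₀ ℕ} :
    SameClass G (a + c) (b + c) ↔ SameClass G a b := by
  simp [SameClass]

lemma edgeMono_eq_prod (e : G.edgeSet) :
    edgeMono K e.val = ∏ i, X i ^ (if i ∈ e.val then 1 else 0) := by
  obtain ⟨e, he⟩ := e
  induction e with | _ u v
  have huv : u ≠ v := G.ne_of_adj he
  have : (univ.filter fun i => i ∈ s(u, v)) = {u, v} := by ext; simp
  simp only [pow_ite, pow_one, pow_zero]
  rw [← prod_filter, this, prod_pair huv]
  rfl

lemma phiG_monomial (a : G.edgeSet →₀ ℕ) (c : K) :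
    phiG K G (monomial a c) = C c * ∏ i, X i ^ vdeg G a i := by
  rw [phiG, aeval_monomial]
  congr 1
  induction a using Finsupp.induction_linear with
  | zero => simp
  | add f g hf hg =>
    rw [Finsupp.prod_add_index' (by simp) (by simp [pow_add]), hf, hg, ← prod_mul_distrib]
    simp [pow_add]
  | single e m =>
    rw [Finsupp.prod_single_index (by simp), edgeMono_eq_prod, ← prod_pow]
    refine prod_congr rfl fun i _ => ?_
    rw [vdeg_single]
    split_ifs <;> simp

lemma sum_vdeg (a : G.edgeSet →₀ ℕ) : ∑ i, vdeg G a i = 2 * a.degree := by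
  induction a using Finsupp.induction_linear with
  | zero => simp
  | add f g hf hg => simp [sum_add_distrib, hf, hg, mul_add]
  | single e m =>
    simp only [vdeg_single, Finsupp.degree_single]
    obtain ⟨e, he⟩ := e
    induction e with | _ u v
    have huv : u ≠ v := G.ne_of_adj he
    have : (univ.filter fun i => i ∈ s(u, v)) = {u, v} := by ext; simp
    rw [← sum_filter, this, sum_pair huv, two_mul]

lemma prod_pow_sub_prod_pow_mem {α β : Fin n → ℕ} (hs : ∑ i, α i = ∑ i, β i)
    (hp : ∀ i, α i % 2 = β i % 2) :
    ∏ i, X i ^ α i - ∏ i, X i ^ β i ∈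
      Ideal.span {f : MvPolynomial (Fin n) K | ∃ i j : Fin n, f = X i ^ 2 - X j ^ 2} := by
  rcases isEmpty_or_nonempty (Fin n) with h | ⟨⟨i₀⟩⟩
  · simp
  set I := Ideal.span {f : MvPolynomial (Fin n) K | ∃ i j : Fin n, f = X i ^ 2 - X j ^ 2}
  rw [← Ideal.Quotient.eq]
  have hsq (i : Fin n) : Ideal.Quotient.mk I (X i) ^ 2 = Ideal.Quotient.mk I (X i₀) ^ 2 := by
    rw [← map_pow, ← map_pow, Ideal.Quotient.eq]
    exact Ideal.subset_span ⟨i, i₀, rfl⟩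
  have key (γ : Fin n → ℕ) : Ideal.Quotient.mk I (∏ i, X i ^ γ i) =
      (∏ i, Ideal.Quotient.mk I (X i) ^ (γ i % 2)) *
        (Ideal.Quotient.mk I (X i₀) ^ 2) ^ (∑ i, γ i / 2) := by
    rw [map_prod, ← prod_pow_eq_pow_sum, ← prod_mul_distrib]
    refine prod_congr rfl fun i _ => ?_
    rw [← hsq i, ← pow_mul, ← pow_add, map_pow, Nat.mod_add_div]
  rw [key, key]
  have hdiv : ∑ i, α i / 2 = ∑ i, β i / 2 := by
    have h1 (γ : Fin n → ℕ) : ∑ i, γ i = ∑ i, γ i % 2 + 2 * ∑ i, γ i / 2 := by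
      rw [mul_sum, ← sum_add_distrib]
      exact sum_congr rfl fun i _ => (Nat.mod_add_div _ _).symm
    have := h1 α
    have := h1 β
    have : ∑ i, α i % 2 = ∑ i, β i % 2 := sum_congr rfl fun i _ => hp i
    omega
  rw [hdiv]
  simp only [hp]

lemma monomial_sub_mem_eulerianIdeal {a b : G.edgeSet →₀ ℕ} (h : SameClass G a b) :
    monomial a (1 : K) - monomial b 1 ∈ eulerianIdeal K G := by
  rw [eulerianIdeal, Ideal.mem_comap, map_sub, phiG_monomial, phiG_monomial, C_1, one_mul,
    one_mul]
  refine prod_pow_sub_prod_pow_mem K ?_ fun i => ?_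
  · rw [sum_vdeg, sum_vdeg, h.1]
  · exact (ZMod.natCast_eq_natCast_iff' _ _ 2).1 (h.2 i)

/-- The grading of `K[x_1, …, x_n]` by degree and exponent parities. -/
noncomputable def parityHom (n : ℕ) :
    MvPolynomial (Fin n) K →ₐ[K] AddMonoidAlgebra K (ℕ × (Fin n → ZMod 2)) :=
  aeval fun i => AddMonoidAlgebra.single (1, Pi.single i 1) 1

lemma parityHom_prod (α : Fin n → ℕ) :
    parityHom K n (∏ i, X i ^ α i) =
      AddMonoidAlgebra.single (∑ i, α i, fun i => (α i : ZMod 2)) 1 := by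
  have h (s : Finset (Fin n)) : parityHom K n (∏ i ∈ s, X i ^ α i) =
      AddMonoidAlgebra.single
        (∑ i ∈ s, α i, ∑ i ∈ s, Pi.single i (α i : ZMod 2)) (1 : K) := by
    induction s using Finset.induction_on with
    | empty => rw [prod_empty, map_one]; rfl
    | insert i s hi ih =>
      rw [prod_insert hi, map_mul, ih, map_pow, parityHom, aeval_X,
        AddMonoidAlgebra.single_pow, AddMonoidAlgebra.single_mul_single, sum_insert hi,
        sum_insert hi]
      simp [← Pi.single_smul]
  rw [h]
  congr
  exact Finset.univ_sum_single fun i => (α i : ZMod 2)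

lemma parityHom_phiG_eq_zero {f : MvPolynomial G.edgeSet K} (hf : f ∈ eulerianIdeal K G) :
    parityHom K n (phiG K G f) = 0 := by
  rw [eulerianIdeal, Ideal.mem_comap] at hf
  have hle : Ideal.span {f : MvPolynomial (Fin n) K | ∃ i j : Fin n, f = X i ^ 2 - X j ^ 2} ≤
      RingHom.ker (parityHom K n) := by
    rw [Ideal.span_le]
    rintro _ ⟨i, j, rfl⟩
    have h2 (i : Fin n) : 2 • (Pi.single i 1 : Fin n → ZMod 2) = 0 := by
      rw [two_nsmul, ← Pi.single_add, show (1 + 1 : ZMod 2) = 0 from rfl, Pi.single_zero]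
    simp [RingHom.mem_ker, parityHom, AddMonoidAlgebra.single_pow, h2]
  exact hle hf

open Classical in
lemma sum_coeff_sameClass_eq_zero {f : MvPolynomial G.edgeSet K} (hf : f ∈ eulerianIdeal K G)
    (a : G.edgeSet →₀ ℕ) :
    ∑ b ∈ f.support with SameClass G b a, coeff b f = 0 := by
  have h := parityHom_phiG_eq_zero K hf
  rw [f.as_sum, map_sum, map_sum] at h
  have h2 := congrArg (fun x => x.coeff (∑ i, vdeg G a i, fun i => (vdeg G a i : ZMod 2))) h
  simp only [phiG_monomial, C_mul', map_smul, parityHom_prod, AddMonoidAlgebra.coeff_sum,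
    AddMonoidAlgebra.coeff_smul, Finsupp.coe_finsetSum, Finset.sum_apply, Finsupp.smul_apply,
    AddMonoidAlgebra.coeff_single, AddMonoidAlgebra.coeff_zero, Finsupp.single_apply,
    sum_vdeg, Finsupp.coe_zero, Pi.zero_apply] at h2
  rw [sum_filter]
  refine (sum_congr rfl fun b _ => ?_).trans h2
  simp only [SameClass, Prod.ext_iff, funext_iff, smul_eq_mul, mul_ite, mul_one, mul_zero,
    Nat.mul_left_cancel_iff two_pos]
  congr

lemma coeff_eq_zero_of_sameClass_unique {f : MvPolynomial G.edgeSet K}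
    (hf : f ∈ eulerianIdeal K G) {a : G.edgeSet →₀ ℕ} (ha : ∀ b, SameClass G b a → b = a) :
    coeff a f = 0 := by
  classical
  by_contra hne
  refine hne ?_
  rw [← sum_coeff_sameClass_eq_zero K hf a, sum_eq_single_of_mem a]
  · simpa using ⟨hne, rfl, fun _ => rfl⟩
  · intro b hb hba
    exact absurd (ha b (mem_filter.1 hb).2) hba

lemma eulerianIdeal_le_of_binomials {I : Ideal (MvPolynomial G.edgeSet K)}
    (hI : ∀ a b, SameClass G a b → monomial a (1 : K) - monomial b 1 ∈ I) :
    eulerianIdeal K G ≤ I := by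
  classical
  intro f hf
  let s : Setoid (G.edgeSet →₀ ℕ) :=
    ⟨SameClass G, fun _ => ⟨rfl, fun _ => rfl⟩, SameClass.symm, SameClass.trans⟩
  let r (a : G.edgeSet →₀ ℕ) : G.edgeSet →₀ ℕ := (Quotient.mk s a).out
  have hr (a) : SameClass G (r a) a := Quotient.mk_out (s := s) a
  have hrr {a b} (h : SameClass G a b) : r a = r b :=
    congrArg Quotient.out (Quotient.sound (s := s) h)
  have hz : ∑ a ∈ f.support, monomial (r a) (coeff a f) = 0 := by
    rw [← sum_fiberwise_of_maps_to (t := f.support.image r) (g := r)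
      fun a ha => mem_image_of_mem r ha]
    refine sum_eq_zero fun c hc => ?_
    obtain ⟨a, -, rfl⟩ := mem_image.1 hc
    have h1 : ∀ b ∈ f.support.filter (fun b => r b = r a),
        monomial (r b) (coeff b f) = monomial (r a) (coeff b f) := by
      intro b hb
      rw [(mem_filter.1 hb).2]
    rw [sum_congr rfl h1, ← map_sum]
    convert map_zero (monomial (R := K) (r a))
    rw [← sum_coeff_sameClass_eq_zero K hf a]
    congr 1
    ext b
    simp only [mem_filter, and_congr_right_iff]
    exact fun _ => ⟨fun h => (hr b).symm.trans (h ▸ hr a), hrr⟩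
  have : f = ∑ a ∈ f.support, C (coeff a f) * (monomial a 1 - monomial (r a) 1) := by
    simp only [mul_sub, C_mul_monomial, mul_one, sum_sub_distrib, hz, sub_zero]
    exact f.as_sum
  rw [this]
  exact sum_mem fun a _ => I.mul_mem_left _ (hI _ _ (hr a).symm)

end Binomials

section Generation

variable {σ K : Type*} [Field K]

lemma IsMinimalHomGenSet.totalDegree_le {I : Ideal (MvPolynomial σ K)}
    {S : Set (MvPolynomial σ K)} (hS : IsMinimalHomGenSet S I) {d : ℕ}
    (hI : I ≤ Ideal.span {g | g ∈ I ∧ ∃ k ≤ d, g.IsHomogeneous k})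
    {f : MvPolynomial σ K} (hf : f ∈ S) : f.totalDegree ≤ d := by
  classical
  obtain ⟨hhom, hspan, hmin⟩ := hS
  by_contra! hlt
  obtain ⟨m, hm⟩ := hhom f hf
  have hm' : f.totalDegree = m := hm.totalDegree fun h => by simp [h] at hlt
  refine hmin f hf (le_antisymm ?_ (hI.trans (Ideal.span_le.2 ?_)))
  · rw [← hspan]
    exact Ideal.span_mono Set.sdiff_subset
  rintro g ⟨hg, k, hk, hgk⟩
  rw [← hspan, ← Set.insert_sdiff_self_of_mem hf, Ideal.mem_span_insert] at hg
  obtain ⟨a, z, hz, rfl⟩ := hg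
  let := gradedAlgebra (R := K) (σ := σ)
  have hhomI : (Ideal.span (S \ {f})).IsHomogeneous (homogeneousSubmodule σ K) :=
    Ideal.homogeneous_span _ _ fun x hx =>
      (hhom x hx.1).imp fun i hi => (mem_homogeneousSubmodule i x).2 hi
  have hcomp : homogeneousComponent k (a * f) = 0 := by
    ext x
    rw [coeff_homogeneousComponent, coeff_zero, coeff_mul]
    split_ifs with hx
    · refine sum_eq_zero fun y hy => ?_
      rw [hm.coeff_eq_zero, mul_zero]
      have := congrArg Finsupp.degree (mem_antidiagonal.1 hy)
      rw [map_add] at this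
      omega
    · rfl
  have hgz : a * f + z = homogeneousComponent k z := by
    conv_lhs => rw [← homogeneousComponent_eq_self hgk, map_add, hcomp, zero_add]
  rw [SetLike.mem_coe, hgz]
  exact homogeneousComponent_mem_of_mem hhomI hz k

lemma coeff_eq_zero_of_mem_span {I : Ideal (MvPolynomial σ K)} {S : Set (MvPolynomial σ K)}
    (hS : ∀ f ∈ S, f ∈ I) {a : σ →₀ ℕ} (hdeg : ∀ f ∈ S, f.totalDegree < a.degree)
    (ha : ∀ f ∈ I, ∀ b ≤ a, b ≠ a → coeff b f = 0) {g : MvPolynomial σ K}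
    (hg : g ∈ Ideal.span S) : coeff a g = 0 := by
  classical
  have hsum (f) (hf : f ∈ S) (h : MvPolynomial σ K) : coeff a (h * f) = 0 := by
    rw [coeff_mul]
    refine sum_eq_zero fun y hy => ?_
    have hy := mem_antidiagonal.1 hy
    by_cases hya : y.2 = a
    · have hlt := hdeg f hf
      rw [Finsupp.degree_apply] at hlt
      rw [hya, coeff_eq_zero_of_totalDegree_lt hlt, mul_zero]
    · rw [ha f (hS f hf) _ (hy ▸ le_add_self) hya, mul_zero]
  rw [Ideal.span, Submodule.mem_span_set] at hg
  obtain ⟨c, hc, rfl⟩ := hg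
  rw [Finsupp.sum, coeff_sum]
  exact sum_eq_zero fun f hf => hsum f (hc hf) _

end Generation

section EdgeSets

open scoped symmDiff

variable {G : SimpleGraph (Fin n)}

lemma natCast_card_symmDiff {α : Type*} [DecidableEq α] (A B : Finset α) :
    ((A ∆ B).card : ZMod 2) = A.card + B.card := by
  have h : (A ∆ B).card + 2 * (A ∩ B).card = A.card + B.card := by
    rw [← card_sdiff_add_card_inter A B, ← card_sdiff_add_card_inter B A, symmDiff_def,
      sup_eq_union, card_union_of_disjoint disjoint_sdiff_sdiff, inter_comm B A]
    ring
  have h2 := congrArg (Nat.cast : ℕ → ZMod 2) h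
  push_cast at h2
  rwa [show (2 : ZMod 2) = 0 from rfl, zero_mul, add_zero] at h2

lemma natCast_degIn_symmDiff (A B : Finset G.edgeSet) (i : Fin n) :
    (degIn G (A ∆ B) i : ZMod 2) = degIn G A i + degIn G B i := by
  rw [degIn, degIn, degIn, ← natCast_card_symmDiff]
  congr 2
  ext e
  simp only [mem_filter, mem_symmDiff]
  tauto

lemma isEulerianSet_iff {C : Finset G.edgeSet} :
    IsEulerianSet G C ↔ ∀ i, (degIn G C i : ZMod 2) = 0 :=
  forall_congr' fun _ => ZMod.natCast_eq_zero_iff_even.symm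

lemma IsEulerianSet.symmDiff {A B : Finset G.edgeSet} (hA : IsEulerianSet G A)
    (hB : IsEulerianSet G B) : IsEulerianSet G (A ∆ B) := by
  rw [isEulerianSet_iff] at *
  simp [natCast_degIn_symmDiff, hA, hB]

lemma even_card_symmDiff {α : Type*} [DecidableEq α] {A B : Finset α} (hA : Even A.card)
    (hB : Even B.card) : Even (A ∆ B).card := by
  rw [← ZMod.natCast_eq_zero_iff_even] at *
  rw [natCast_card_symmDiff, hA, hB, add_zero]

lemma IsEulerianSet.sdiff {A B : Finset G.edgeSet} (hA : IsEulerianSet G A)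
    (hB : IsEulerianSet G B) (h : B ⊆ A) : IsEulerianSet G (A \ B) := by
  rw [← symmDiff_of_ge h]
  exact hA.symmDiff hB

lemma sum_degIn (A : Finset (Fin n)) (C : Finset G.edgeSet) :
    ∑ i ∈ A, degIn G C i = ∑ e ∈ C, (A.filter fun i => i ∈ e.val).card :=
  sum_card_bipartiteAbove_eq_sum_card_bipartiteBelow _

lemma sum_univ_degIn (C : Finset G.edgeSet) : ∑ i, degIn G C i = 2 * C.card := by
  rw [sum_degIn, mul_comm, ← smul_eq_mul, ← sum_const]
  refine sum_congr rfl fun e _ => ?_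
  obtain ⟨e, he⟩ := e
  induction e with | _ u v
  have : (univ.filter fun i => i ∈ s(u, v)) = {u, v} := by ext; simp
  rw [this, card_pair (G.ne_of_adj he)]

lemma IsEulerianSet.even_card_of_colorable {C : Finset G.edgeSet} (hC : IsEulerianSet G C)
    (hG : G.Colorable 2) : Even C.card := by
  obtain ⟨c⟩ := hG
  have h : ∑ i with c i = 0, degIn G C i = C.card := by
    rw [sum_degIn, card_eq_sum_ones]
    refine sum_congr rfl fun e _ => ?_
    obtain ⟨e, he⟩ := e
    induction e with | _ u v
    have hne : c u ≠ c v := c.valid he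
    rw [filter_filter, card_eq_one]
    by_cases hu : c u = 0
    · refine ⟨u, ?_⟩
      ext x
      simp only [mem_filter, mem_univ, true_and, Sym2.mem_iff, mem_singleton]
      grind
    · refine ⟨v, ?_⟩
      ext x
      simp only [mem_filter, mem_univ, true_and, Sym2.mem_iff, mem_singleton]
      grind
  rw [← h]
  exact even_sum _ fun i _ => hC i

/-- The set of edges of a walk. -/
noncomputable def walkEdges {u v : Fin n} (w : G.Walk u v) : Finset G.edgeSet :=
  w.edges.toFinset.preimage Subtype.val Subtype.val_injective.injOn

lemma mem_walkEdges {u v : Fin n} {w : G.Walk u v} {e : G.edgeSet} :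
    e ∈ walkEdges w ↔ e.val ∈ w.edges := by
  simp [walkEdges]

lemma image_walkEdges {u v : Fin n} (w : G.Walk u v) :
    (walkEdges w).image (fun e => e.val) = w.edges.toFinset := by
  ext e
  simp only [mem_image, mem_walkEdges, List.mem_toFinset]
  exact ⟨by rintro ⟨e, he, rfl⟩; exact he, fun he => ⟨⟨e, w.edges_subset_edgeSet he⟩, he, rfl⟩⟩

lemma isCycleSet_iff {C : Finset G.edgeSet} :
    IsCycleSet G C ↔ ∃ (v : Fin n) (w : G.Walk v v), w.IsCycle ∧ C = walkEdges w := by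
  simp only [IsCycleSet, ← image_walkEdges, (image_injective Subtype.val_injective).eq_iff]

lemma card_walkEdges {u v : Fin n} {w : G.Walk u v} (hw : w.IsTrail) :
    (walkEdges w).card = w.length := by
  rw [← card_image_of_injective _ Subtype.val_injective, image_walkEdges,
    List.toFinset_card_of_nodup hw.edges_nodup, w.length_edges]

lemma degIn_walkEdges {u v : Fin n} {w : G.Walk u v} (hw : w.IsTrail) (x : Fin n) :
    degIn G (walkEdges w) x = w.edges.countP fun e => x ∈ e := by
  have h : ((walkEdges w).filter fun e => x ∈ e.val).image (fun e => e.val) =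
      (w.edges.filter fun e => x ∈ e).toFinset := by
    rw [List.toFinset_filter, ← image_walkEdges, filter_image]
    simp
  rw [degIn, ← card_image_of_injective _ Subtype.val_injective, h,
    List.toFinset_card_of_nodup (hw.edges_nodup.filter _), List.countP_eq_length_filter]

lemma even_degIn_walkEdges_iff {u v : Fin n} {w : G.Walk u v} (hw : w.IsTrail) (x : Fin n) :
    Even (degIn G (walkEdges w) x) ↔ u ≠ v → x ≠ u ∧ x ≠ v := by
  rw [degIn_walkEdges hw, hw.even_countP_edges_iff]

lemma edgeVerts_walkEdges {u v : Fin n} {w : G.Walk u v} (hw : ¬ w.Nil) :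
    edgeVerts G (walkEdges w) = w.support.toFinset := by
  ext x
  simp only [edgeVerts, mem_filter, mem_univ, true_and, mem_walkEdges, List.mem_toFinset,
    SimpleGraph.Walk.mem_support_iff_exists_mem_edges_of_not_nil hw]
  exact ⟨fun ⟨e, he, hx⟩ => ⟨e, he, hx⟩,
    fun ⟨e, he, hx⟩ => ⟨⟨e, w.edges_subset_edgeSet he⟩, he, hx⟩⟩

lemma edgeVerts_mono {A B : Finset G.edgeSet} (h : A ⊆ B) : edgeVerts G A ⊆ edgeVerts G B := by
  intro x
  simp only [edgeVerts, mem_filter, mem_univ, true_and]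
  exact fun ⟨e, he, hx⟩ => ⟨e, h he, hx⟩

lemma mem_edgeVerts_iff {C : Finset G.edgeSet} {x : Fin n} :
    x ∈ edgeVerts G C ↔ 0 < degIn G C x := by
  simp [edgeVerts, degIn, card_pos, filter_nonempty_iff]

lemma IsCycleSet.isEulerianSet {C : Finset G.edgeSet} (hC : IsCycleSet G C) :
    IsEulerianSet G C := by
  obtain ⟨v, w, hw, rfl⟩ := isCycleSet_iff.1 hC
  exact fun x => (even_degIn_walkEdges_iff hw.isTrail x).2 (absurd rfl)

lemma IsCycleSet.three_le_card {C : Finset G.edgeSet} (hC : IsCycleSet G C) : 3 ≤ C.card := by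
  obtain ⟨v, w, hw, rfl⟩ := isCycleSet_iff.1 hC
  rw [card_walkEdges hw.isTrail]
  exact hw.three_le_length

lemma IsCycleSet.nonempty {C : Finset G.edgeSet} (hC : IsCycleSet G C) : C.Nonempty :=
  card_pos.1 (by have := hC.three_le_card; omega)

lemma IsCycleSet.card_edgeVerts {C : Finset G.edgeSet} (hC : IsCycleSet G C) :
    (edgeVerts G C).card = C.card := by
  obtain ⟨v, w, hw, rfl⟩ := isCycleSet_iff.1 hC
  have h : w.support.toFinset = w.support.tail.toFinset := by
    rw [← w.cons_tail_support, List.toFinset_cons, List.tail_cons, insert_eq_self,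
      List.mem_toFinset]
    exact w.end_mem_tail_support hw.not_nil
  rw [edgeVerts_walkEdges hw.not_nil, h, List.toFinset_card_of_nodup hw.support_nodup,
    card_walkEdges hw.isTrail, List.length_tail, w.length_support, Nat.add_sub_cancel]

lemma IsCycleSet.degIn_eq_two {C : Finset G.edgeSet} (hC : IsCycleSet G C) {x : Fin n}
    (hx : x ∈ edgeVerts G C) : degIn G C x = 2 := by
  have h2 (y) (hy : y ∈ edgeVerts G C) : 2 ≤ degIn G C y := by
    obtain ⟨k, hk⟩ := hC.isEulerianSet y
    have := mem_edgeVerts_iff.1 hy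
    omega
  have hsum : ∑ y ∈ edgeVerts G C, 2 = ∑ y ∈ edgeVerts G C, degIn G C y := by
    rw [sum_const, smul_eq_mul, hC.card_edgeVerts, mul_comm, ← sum_univ_degIn]
    refine (sum_subset (subset_univ _) fun y _ hy => ?_).symm
    rw [mem_edgeVerts_iff] at hy
    omega
  exact ((sum_eq_sum_iff_of_le h2).1 hsum x hx).symm

/-- Two vertices of a cycle are the odd vertices of some set of edges of the cycle. -/
lemma IsCycleSet.exists_subset_odd_degIn {C : Finset G.edgeSet} (hC : IsCycleSet G C)
    {u v : Fin n} (huv : u ≠ v) (hu : u ∈ edgeVerts G C) (hv : v ∈ edgeVerts G C) :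
    ∃ P ⊆ C, ∀ x, Even (degIn G P x) ↔ x ≠ u ∧ x ≠ v := by
  obtain ⟨a, w, hw, rfl⟩ := isCycleSet_iff.1 hC
  rw [edgeVerts_walkEdges hw.not_nil, List.mem_toFinset] at hu hv
  have hw' := (SimpleGraph.Walk.isCycle_rotate hu).2 hw
  have hmem (e) : e ∈ (w.rotate u hu).edges ↔ e ∈ w.edges := (w.rotate_edges u hu).mem_iff
  have hv' : v ∈ (w.rotate u hu).support := by
    rw [SimpleGraph.Walk.mem_support_iff_exists_mem_edges_of_not_nil hw'.not_nil]
    rw [SimpleGraph.Walk.mem_support_iff_exists_mem_edges_of_not_nil hw.not_nil] at hv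
    simpa only [hmem] using hv
  refine ⟨walkEdges ((w.rotate u hu).takeUntil v hv'), fun e he => ?_, fun x => ?_⟩
  · rw [mem_walkEdges] at *
    exact (hmem _).1 (SimpleGraph.Walk.edges_takeUntil_subset_edges _ hv' he)
  · rw [even_degIn_walkEdges_iff (hw'.isTrail.takeUntil hv')]
    simp [huv]

lemma IsEulerianSet.exists_isCycleSet_subset {C : Finset G.edgeSet} (hC : IsEulerianSet G C)
    (hne : C.Nonempty) : ∃ Z ⊆ C, IsCycleSet G Z := by
  classical
  set H : SimpleGraph (Fin n) := SimpleGraph.fromEdgeSet (C.image (fun e => e.val)) with hH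
  have hadj {x y : Fin n} : H.Adj x y ↔ ∃ h : G.Adj x y, (⟨s(x, y), h⟩ : G.edgeSet) ∈ C := by
    rw [hH, SimpleGraph.fromEdgeSet_adj]
    constructor
    · rintro ⟨h, -⟩
      obtain ⟨⟨e, he'⟩, he, rfl⟩ := mem_image.1 (mem_coe.1 h)
      exact ⟨he', he⟩
    · rintro ⟨h, h'⟩
      exact ⟨mem_coe.2 (mem_image.2 ⟨_, h', rfl⟩), G.ne_of_adj h⟩
  have hle : H ≤ G := fun x y h => (hadj.1 h).1
  by_cases hac : H.IsAcyclic
  · exfalso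
    obtain ⟨⟨e, he'⟩, he⟩ := hne
    induction e with | _ u v
    have hbr := SimpleGraph.isAcyclic_iff_forall_isBridge.1 hac
      ((SimpleGraph.mem_edgeSet _).2 (hadj.2 ⟨he', he⟩))
    rw [SimpleGraph.isBridge_iff] at hbr
    set A : Finset (Fin n) :=
      univ.filter fun x => (H.deleteEdges {s(u, v)}).Reachable u x with hA
    have hu : u ∈ A := by simp [hA]
    have hv : v ∉ A := by simpa [hA] using hbr
    have hsum : Even (∑ x ∈ A, degIn G C x) := even_sum _ fun x _ => hC x
    rw [sum_degIn, ← add_sum_erase _ _ he] at hsum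
    have h1 : (A.filter fun x => x ∈ s(u, v)).card = 1 := by
      rw [card_eq_one]
      refine ⟨u, ?_⟩
      ext x
      simp only [mem_filter, Sym2.mem_iff, mem_singleton]
      grind
    have h2 : Even (∑ e ∈ C.erase ⟨s(u, v), he'⟩, (A.filter fun x => x ∈ e.val).card) := by
      refine even_sum _ fun e hemem => ?_
      obtain ⟨hne, hemem⟩ := mem_erase.1 hemem
      obtain ⟨e, hee⟩ := e
      induction e with | _ x y
      have hxy : (H.deleteEdges {s(u, v)}).Adj x y := by
        rw [SimpleGraph.deleteEdges_adj]
        exact ⟨hadj.2 ⟨hee, hemem⟩, fun h => hne (Subtype.ext h)⟩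
      have hiff : x ∈ A ↔ y ∈ A := by
        simp only [hA, mem_filter, mem_univ, true_and]
        exact ⟨fun h => h.trans hxy.reachable, fun h => h.trans hxy.symm.reachable⟩
      by_cases hx : x ∈ A
      · have : (A.filter fun z => z ∈ s(x, y)) = {x, y} := by
          ext z
          simp only [mem_filter, Sym2.mem_iff, mem_insert, mem_singleton]
          grind
        rw [this, card_pair (G.ne_of_adj hee)]
        exact even_two
      · have : (A.filter fun z => z ∈ s(x, y)) = ∅ := by
          ext z
          simp only [mem_filter, Sym2.mem_iff, notMem_empty]
          grind
        rw [this]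
        exact Even.zero
    rw [h1, Nat.even_add] at hsum
    exact Nat.not_even_one (hsum.2 h2)
  · simp only [SimpleGraph.IsAcyclic, not_forall, not_not] at hac
    obtain ⟨v, w, hw⟩ := hac
    refine ⟨walkEdges (w.mapLe hle), fun e he => ?_,
      isCycleSet_iff.2 ⟨v, _, (SimpleGraph.Walk.isCycle_mapLe hle).2 hw, rfl⟩⟩
    rw [mem_walkEdges, SimpleGraph.Walk.edges_mapLe_eq_edges] at he
    have := w.edges_subset_edgeSet he
    obtain ⟨e, hee⟩ := e
    induction e with | _ x y
    exact (hadj.1 this).2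

lemma IsEulerianSet.three_le_card {C : Finset G.edgeSet} (hC : IsEulerianSet G C)
    (hne : C.Nonempty) : 3 ≤ C.card := by
  obtain ⟨Z, hZ, hcyc⟩ := hC.exists_isCycleSet_subset hne
  exact hcyc.three_le_card.trans (card_le_card hZ)

end EdgeSets

section SpecialSets

open scoped symmDiff

variable {G : SimpleGraph (Fin n)}

lemma IsCycleSet.exists_even_subset_odd_degIn {C : Finset G.edgeSet} (hC : IsCycleSet G C)
    (hodd : Odd C.card) {u v : Fin n} (huv : u ≠ v) (hu : u ∈ edgeVerts G C)
    (hv : v ∈ edgeVerts G C) :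
    ∃ P ⊆ C, Even P.card ∧ ∀ x, Even (degIn G P x) ↔ x ≠ u ∧ x ≠ v := by
  obtain ⟨P, hPC, hP⟩ := hC.exists_subset_odd_degIn huv hu hv
  by_cases hcard : Even P.card
  · exact ⟨P, hPC, hcard, hP⟩
  refine ⟨C \ P, sdiff_subset, ?_, fun x => ?_⟩
  · rw [card_sdiff_of_subset hPC]
    exact Nat.Odd.sub_odd hodd (Nat.not_even_iff_odd.1 hcard)
  · rw [← hP, ← ZMod.natCast_eq_zero_iff_even, ← ZMod.natCast_eq_zero_iff_even,
      ← symmDiff_of_ge (show P ≤ C from hPC), natCast_degIn_symmDiff,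
      isEulerianSet_iff.1 hC.isEulerianSet, zero_add]

/-- A minimal nonempty even Eulerian set without even-chords is special. -/
lemma specialSet_of_minimal {C : Finset G.edgeSet} (hC : IsEulerianSet G C)
    (hcard : Even C.card) (hne : C.Nonempty)
    (hmin : ∀ D ⊆ C, IsEulerianSet G D → Even D.card → D.Nonempty → D = C)
    (hch : ¬ ∃ l, IsEvenChord G C l) : SpecialSet G C := by
  refine ⟨?_, hch⟩
  obtain ⟨Z, hZC, hZ⟩ := hC.exists_isCycleSet_subset hne
  by_cases hZe : Even Z.card
  · rw [← hmin Z hZC hZ.isEulerianSet hZe hZ.nonempty]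
    exact Or.inl ⟨hZ, hZe⟩
  have hne' : (C \ Z).Nonempty := by
    rw [sdiff_nonempty]
    intro h
    exact hZe (h.antisymm hZC ▸ hcard)
  obtain ⟨Y, hYC, hY⟩ := (hC.sdiff hZ.isEulerianSet hZC).exists_isCycleSet_subset hne'
  have hdisj : Disjoint Z Y := disjoint_sdiff.mono_right hYC
  replace hYC : Y ⊆ C := hYC.trans sdiff_subset
  have hYe : ¬ Even Y.card := by
    intro h
    have h1 := hmin Y hYC hY.isEulerianSet h hY.nonempty
    rw [h1] at hdisj
    exact hZ.nonempty.ne_empty (hdisj.eq_bot_of_le hZC)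
  rw [Nat.not_even_iff_odd] at hZe hYe
  refine Or.inr ⟨Z, Y, hZ, hZe, hY, hYe, hdisj, ?_, ?_⟩
  · by_contra! hlt
    obtain ⟨u, hu, v, hv, huv⟩ := one_lt_card.1 hlt
    rw [mem_inter] at hu hv
    obtain ⟨P, hPZ, hPe, hP⟩ := hZ.exists_even_subset_odd_degIn hZe huv hu.1 hv.1
    obtain ⟨Q, hQY, hQe, hQ⟩ := hY.exists_even_subset_odd_degIn hYe huv hu.2 hv.2
    have hPQ : P ∆ Q = C := by
      refine hmin _ (symmDiff_le_sup.trans (union_subset (hPZ.trans hZC) (hQY.trans hYC)))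
        (fun x => ?_) (even_card_symmDiff hPe hQe) ?_
      · rw [← ZMod.natCast_eq_zero_iff_even, natCast_degIn_symmDiff,
          ← Nat.cast_add, ZMod.natCast_eq_zero_iff_even, Nat.even_add, hP, hQ]
      · rw [nonempty_iff_ne_empty, ← bot_eq_empty, Ne, symmDiff_eq_bot]
        rintro rfl
        have h0 : P = ∅ := (hdisj.mono hPZ hQY).eq_bot_of_self
        exact ((hP u).1 (by simp [h0, degIn])).1 rfl
    obtain ⟨e, heZ, heP⟩ := exists_of_ssubset (hPZ.ssubset_of_ne fun h =>
      Nat.not_even_iff_odd.2 hZe (h ▸ hPe))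
    have := hZC heZ
    rw [← hPQ, mem_symmDiff] at this
    exact disjoint_left.1 hdisj heZ (hQY (this.resolve_left fun h => heP h.1).1)
  · rw [← sup_eq_union, ← hdisj.symmDiff_eq_sup]
    refine (hmin _ (symmDiff_le_sup.trans (union_subset hZC hYC))
      (hZ.isEulerianSet.symmDiff hY.isEulerianSet) ?_ ?_).symm
    · rw [hdisj.symmDiff_eq_sup, sup_eq_union, card_union_of_disjoint hdisj]
      exact hZe.add_odd hYe
    · rw [hdisj.symmDiff_eq_sup]
      exact hZ.nonempty.mono subset_union_left

/-- An even Eulerian set which is not special splits into two smaller ones. -/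
lemma exists_symmDiff_eq_of_not_specialSet {C : Finset G.edgeSet} (hC : IsEulerianSet G C)
    (hcard : Even C.card) (hne : C.Nonempty) (hsp : ¬ SpecialSet G C) :
    ∃ C₁ C₂, IsEulerianSet G C₁ ∧ Even C₁.card ∧ C₁.Nonempty ∧
      IsEulerianSet G C₂ ∧ Even C₂.card ∧ C₂.Nonempty ∧ (C₁ ∩ C₂).card ≤ 1 ∧ C = C₁ ∆ C₂ := by
  by_cases hch : ∃ l, IsEvenChord G C l
  · obtain ⟨l, hl, C₁, C₂, h₁, h₁', h₂, h₂', hl', h⟩ := hch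
    have hmem : l ∈ C₁ ∩ C₂ := hl' ▸ mem_singleton_self l
    rw [mem_inter] at hmem
    exact ⟨C₁, C₂, h₁, h₁', ⟨l, hmem.1⟩, h₂, h₂', ⟨l, hmem.2⟩, by simp [hl'], h⟩
  · by_contra hno
    refine hsp (specialSet_of_minimal hC hcard hne (fun D hD hDE hDe hDne => ?_) hch)
    by_contra hDC
    refine hno ⟨D, C \ D, hDE, hDe, hDne, hC.sdiff hDE hD, ?_, ?_, ?_, ?_⟩
    · rw [card_sdiff_of_subset hD]
      exact Even.tsub hcard hDe
    · exact sdiff_nonempty.2 fun h => hDC (hD.antisymm h)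
    · simp
    · rw [disjoint_sdiff.symmDiff_eq_sup, sup_eq_union, union_sdiff_of_subset hD]

end SpecialSets

section Indicator

variable {G : SimpleGraph (Fin n)}

/-- The exponent vector of the squarefree monomial `t_J`. -/
noncomputable def edgeInd (J : Finset G.edgeSet) : G.edgeSet →₀ ℕ :=
  ∑ e ∈ J, Finsupp.single e 1

lemma edgeInd_apply (J : Finset G.edgeSet) (e : G.edgeSet) :
    edgeInd J e = if e ∈ J then 1 else 0 := by
  simp [edgeInd, Finsupp.finsetSum_apply, Finsupp.single_apply]

lemma degree_edgeInd (J : Finset G.edgeSet) : (edgeInd J).degree = J.card := by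
  simp [edgeInd]

lemma vdeg_edgeInd (J : Finset G.edgeSet) (i : Fin n) :
    vdeg G (edgeInd J) i = degIn G J i := by
  simp [edgeInd, vdeg_single, degIn]

lemma support_edgeInd (J : Finset G.edgeSet) : (edgeInd J).support = J := by
  ext e
  simp [edgeInd_apply]

lemma edgeInd_support {a : G.edgeSet →₀ ℕ} (ha : ∀ e, a e ≤ 1) : edgeInd a.support = a := by
  ext e
  have := ha e
  rw [edgeInd_apply]
  split_ifs with h <;> rw [Finsupp.mem_support_iff] at h <;> omega

open scoped symmDiff in
lemma isEulerianSet_symmDiff_iff {J K : Finset G.edgeSet} : IsEulerianSet G (J ∆ K) ↔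
    ∀ i, (vdeg G (edgeInd J) i : ZMod 2) = vdeg G (edgeInd K) i := by
  simp only [isEulerianSet_iff, natCast_degIn_symmDiff, vdeg_edgeInd, CharTwo.add_eq_zero]

end Indicator

section UpperBound

open scoped symmDiff

lemma card_of_symmDiff_eq {α : Type*} [DecidableEq α] {J K A B : Finset α}
    (hJK : Disjoint J K) (h : J ∆ K = A ∆ B) :
    (J ∆ A).card = (J \ A).card + (K ∩ A).card + (A ∩ B).card ∧
      A.card = (J ∩ A).card + (K ∩ A).card + (A ∩ B).card ∧
      B.card = (J \ A).card + (K \ A).card + (A ∩ B).card := by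
  rw [disjoint_left] at hJK
  have h' (e) : (e ∈ J ∧ e ∉ K ∨ e ∈ K ∧ e ∉ J) ↔ (e ∈ A ∧ e ∉ B ∨ e ∈ B ∧ e ∉ A) := by
    rw [← mem_symmDiff, h, mem_symmDiff]
  refine ⟨?_, ?_, ?_⟩
  all_goals
    rw [← card_union_of_disjoint, ← card_union_of_disjoint]
    · congr 1
      ext e
      simp only [mem_symmDiff, mem_union, mem_sdiff, mem_inter]
      grind
    all_goals
      rw [disjoint_left]
      intro e
      simp only [mem_union, mem_sdiff, mem_inter]
      grind

variable {K : Type*} [Field K] {G : SimpleGraph (Fin n)} {I : Ideal (MvPolynomial G.edgeSet K)}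

lemma monomial_sub_mem_of_common {k : ℕ}
    (ih : ∀ a b, SameClass G a b → a.degree < k → monomial a (1 : K) - monomial b 1 ∈ I)
    {a b : G.edgeSet →₀ ℕ} (h : SameClass G a b) (hk : a.degree = k) {e : G.edgeSet}
    (ha : a e ≠ 0) (hb : b e ≠ 0) : monomial a (1 : K) - monomial b 1 ∈ I := by
  obtain ⟨a, rfl⟩ : ∃ a', a = a' + Finsupp.single e 1 :=
    ⟨_, (tsub_add_cancel_of_le (Finsupp.single_le_iff.2 (Nat.one_le_iff_ne_zero.2 ha))).symm⟩
  obtain ⟨b, rfl⟩ : ∃ b', b = b' + Finsupp.single e 1 :=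
    ⟨_, (tsub_add_cancel_of_le (Finsupp.single_le_iff.2 (Nat.one_le_iff_ne_zero.2 hb))).symm⟩
  rw [map_add, Finsupp.degree_single] at hk
  have := I.mul_mem_right (X e) (ih a b (sameClass_add_iff.1 h) (by omega))
  rwa [sub_mul, X, monomial_mul, monomial_mul, one_mul] at this

lemma monomial_sub_mem_of_two_le {d k : ℕ} (hd : 2 ≤ d)
    (hI : ∀ a b, SameClass G a b → a.degree ≤ d → monomial a (1 : K) - monomial b 1 ∈ I)
    (ih : ∀ a b, SameClass G a b → a.degree < k → monomial a (1 : K) - monomial b 1 ∈ I)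
    {a b : G.edgeSet →₀ ℕ} (h : SameClass G a b) (hk : a.degree = k) {e : G.edgeSet}
    (ha : 2 ≤ a e) : monomial a (1 : K) - monomial b 1 ∈ I := by
  obtain ⟨a, rfl⟩ : ∃ a', a = a' + Finsupp.single e 2 :=
    ⟨_, (tsub_add_cancel_of_le (Finsupp.single_le_iff.2 ha)).symm⟩
  rw [map_add, Finsupp.degree_single] at hk
  have hb : b ≠ 0 := by
    rintro rfl
    have := h.1
    rw [map_add, Finsupp.degree_single, map_zero] at this
    omega
  obtain ⟨f, hf⟩ := Finsupp.ne_iff.1 hb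
  have h2 : SameClass G (Finsupp.single e 2) (Finsupp.single f 2) := by
    refine ⟨by simp, fun i => ?_⟩
    rw [vdeg_single, vdeg_single]
    split_ifs <;> rfl
  have hsame : SameClass G (a + Finsupp.single e 2) (a + Finsupp.single f 2) := by
    rw [add_comm a, add_comm a]
    exact sameClass_add_iff.2 h2
  have h3 := I.mul_mem_left (monomial a 1) (hI _ _ h2 (by simpa using hd))
  rw [mul_sub, monomial_mul, monomial_mul, one_mul] at h3
  have h4 : monomial (a + Finsupp.single f 2) (1 : K) - monomial b 1 ∈ I :=
    monomial_sub_mem_of_common ih (hsame.symm.trans h) (by simpa using hk) (e := f) (by simp) hf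
  rw [← sub_add_sub_cancel _ (monomial (a + Finsupp.single f 2) (1 : K))]
  exact add_mem h3 h4

lemma monomial_sub_mem_comm {a b : G.edgeSet →₀ ℕ} :
    monomial a (1 : K) - monomial b 1 ∈ I ↔ monomial b (1 : K) - monomial a 1 ∈ I := by
  rw [← neg_sub, neg_mem_iff]

lemma monomial_sub_mem_of_symmDiff_eq {d : ℕ} (hd : 2 ≤ d)
    (hI : ∀ a b, SameClass G a b → a.degree ≤ d → monomial a (1 : K) - monomial b 1 ∈ I)
    {J L A B : Finset G.edgeSet}
    (ih : ∀ a b, SameClass G a b → a.degree < J.card →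
      monomial a (1 : K) - monomial b 1 ∈ I)
    (h : SameClass G (edgeInd J) (edgeInd L)) (hJL : Disjoint J L) (hAB : J ∆ L = A ∆ B)
    (hA : IsEulerianSet G A) (hAe : Even A.card) (hA3 : 3 ≤ A.card) (hB3 : 3 ≤ B.card)
    (hcap : (A ∩ B).card ≤ 1) (hle : (J ∆ A).card ≤ J.card) :
    monomial (edgeInd J) (1 : K) - monomial (edgeInd L) 1 ∈ I := by
  have hcard : J.card = L.card := by simpa [degree_edgeInd] using h.1
  obtain ⟨c1, c2, c3⟩ := card_of_symmDiff_eq hJL hAB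
  have c4 := card_inter_add_card_sdiff J A
  have c5 := card_inter_add_card_sdiff L A
  have hpar : Even (J.card - (J ∆ A).card) := by
    rw [Nat.even_sub hle, ← ZMod.natCast_eq_zero_iff_even, ← ZMod.natCast_eq_zero_iff_even,
      natCast_card_symmDiff, (ZMod.natCast_eq_zero_iff_even).2 hAe, add_zero]
  obtain ⟨e₀, -⟩ : J.Nonempty := card_pos.1 (by omega)
  set c : G.edgeSet →₀ ℕ :=
    edgeInd (J ∆ A) + Finsupp.single e₀ (J.card - (J ∆ A).card) with hc
  have hcdeg : c.degree = J.card := by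
    rw [hc, map_add, degree_edgeInd, Finsupp.degree_single]
    omega
  have hcJ : SameClass G c (edgeInd J) := by
    refine ⟨by rw [hcdeg, degree_edgeInd], fun i => ?_⟩
    have h0 : (vdeg G (Finsupp.single e₀ (J.card - (J ∆ A).card)) i : ZMod 2) = 0 := by
      rw [vdeg_single, ZMod.natCast_eq_zero_iff_even]
      split_ifs
      exacts [hpar, Even.zero]
    rw [hc, map_add, Pi.add_apply, Nat.cast_add, h0, add_zero, vdeg_edgeInd, vdeg_edgeInd,
      natCast_degIn_symmDiff, isEulerianSet_iff.1 hA, add_zero]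
  have hcL := hcJ.trans h
  obtain ⟨h1, h2⟩ : monomial c (1 : K) - monomial (edgeInd J) 1 ∈ I ∧
      monomial c (1 : K) - monomial (edgeInd L) 1 ∈ I := by
    rcases hle.lt_or_eq with hlt | heq
    · have h2 : 2 ≤ c e₀ := by
        rw [hc, Finsupp.add_apply, Finsupp.single_eq_same]
        obtain ⟨r, hr⟩ := hpar
        omega
      exact ⟨monomial_sub_mem_of_two_le hd hI ih hcJ hcdeg h2,
        monomial_sub_mem_of_two_le hd hI ih hcL hcdeg h2⟩
    · have hc' : c = edgeInd (J ∆ A) := by simp [hc, heq]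
      obtain ⟨e, he⟩ : (J \ A).Nonempty := card_pos.1 (by omega)
      obtain ⟨f, hf⟩ : (L ∩ A).Nonempty := card_pos.1 (by omega)
      rw [mem_sdiff] at he
      rw [mem_inter] at hf
      have hfJ : f ∉ J := disjoint_right.1 hJL hf.1
      refine ⟨monomial_sub_mem_of_common ih hcJ hcdeg (e := e) ?_ ?_,
        monomial_sub_mem_of_common ih hcL hcdeg (e := f) ?_ ?_⟩ <;>
      simp [hc', edgeInd_apply, mem_symmDiff, he, hf, hfJ]
  rw [← sub_sub_sub_cancel_left _ _ (monomial c (1 : K))]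
  exact sub_mem h2 h1

lemma monomial_sub_mem_of_forall_degree_le {d : ℕ} (hd : 2 ≤ d)
    (hmax : ∀ C : Finset G.edgeSet, SpecialSet G C → C.card ≤ 2 * d)
    (hI : ∀ a b, SameClass G a b → a.degree ≤ d → monomial a (1 : K) - monomial b 1 ∈ I)
    {a b : G.edgeSet →₀ ℕ} (h : SameClass G a b) :
    monomial a (1 : K) - monomial b 1 ∈ I := by
  induction hk : a.degree using Nat.strong_induction_on generalizing a b with | _ k IH
  have ih (a b) (h : SameClass G a b) (hlt : a.degree < k) :
      monomial a (1 : K) - monomial b 1 ∈ I := IH _ hlt h rfl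
  by_cases hkd : k ≤ d
  · exact hI a b h (hk.trans_le hkd)
  by_cases hcom : ∃ e, a e ≠ 0 ∧ b e ≠ 0
  · obtain ⟨e, ha, hb⟩ := hcom
    exact monomial_sub_mem_of_common ih h hk ha hb
  by_cases ha : ∃ e, 2 ≤ a e
  · obtain ⟨e, ha⟩ := ha
    exact monomial_sub_mem_of_two_le hd hI ih h hk ha
  by_cases hb : ∃ e, 2 ≤ b e
  · obtain ⟨e, hb⟩ := hb
    exact monomial_sub_mem_comm.1
      (monomial_sub_mem_of_two_le hd hI ih h.symm (h.1.symm.trans hk) hb)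
  push Not at ha hb hcom
  obtain ⟨J, rfl⟩ : ∃ J, a = edgeInd J :=
    ⟨_, (edgeInd_support fun e => Nat.lt_succ_iff.1 (ha e)).symm⟩
  obtain ⟨L, rfl⟩ : ∃ L, b = edgeInd L :=
    ⟨_, (edgeInd_support fun e => Nat.lt_succ_iff.1 (hb e)).symm⟩
  have hJL : Disjoint J L := by
    rw [disjoint_left]
    intro e heJ heL
    simpa [edgeInd_apply, heJ, heL] using hcom e
  have hL : L.card = k := by rw [← degree_edgeInd, ← h.1, hk]
  rw [degree_edgeInd] at hk
  have hcard : (J ∆ L).card = 2 * k := by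
    rw [hJL.symmDiff_eq_sup, sup_eq_union, card_union_of_disjoint hJL, hk, hL, two_mul]
  obtain ⟨A, B, hA, hAe, hAne, hB, hBe, hBne, hcap, hAB⟩ :=
    exists_symmDiff_eq_of_not_specialSet (isEulerianSet_symmDiff_iff.2 h.2)
      (hcard ▸ even_two_mul k) (card_pos.1 (by omega))
      fun hsp => by have := hmax _ hsp; omega
  subst hk
  by_cases hle : (J ∆ A).card ≤ J.card
  · exact monomial_sub_mem_of_symmDiff_eq hd hI ih h hJL hAB hA hAe (hA.three_le_card hAne)
      (hB.three_le_card hBne) hcap hle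
  rw [monomial_sub_mem_comm]
  have hLJ : L ∆ J = A ∆ B := symmDiff_comm J L ▸ hAB
  refine monomial_sub_mem_of_symmDiff_eq hd hI (hL ▸ ih) h.symm hJL.symm hLJ hA hAe
    (hA.three_le_card hAne) (hB.three_le_card hBne) hcap ?_
  obtain ⟨c1, c2, -⟩ := card_of_symmDiff_eq hJL hAB
  obtain ⟨c3, -⟩ := card_of_symmDiff_eq hJL.symm hLJ
  have c4 := card_inter_add_card_sdiff J A
  have c5 := card_inter_add_card_sdiff L A
  obtain ⟨r, hr⟩ := hAe
  omega

lemma IsMinimalHomGenSet.totalDegree_le_of_specialSet {d : ℕ} (hd : 2 ≤ d)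
    (hmax : ∀ C : Finset G.edgeSet, SpecialSet G C → C.card ≤ 2 * d)
    {S : Set (MvPolynomial G.edgeSet K)} (hS : IsMinimalHomGenSet S (eulerianIdeal K G))
    {f : MvPolynomial G.edgeSet K} (hf : f ∈ S) : f.totalDegree ≤ d := by
  refine hS.totalDegree_le (eulerianIdeal_le_of_binomials K fun a b h =>
    monomial_sub_mem_of_forall_degree_le hd hmax (fun a b h hle => ?_) h) hf
  exact Ideal.subset_span ⟨monomial_sub_mem_eulerianIdeal K h, a.degree, hle,
    (isHomogeneous_monomial _ rfl).sub (isHomogeneous_monomial _ h.1.symm)⟩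

end UpperBound

section LowerBound

open scoped symmDiff

variable {G : SimpleGraph (Fin n)}

lemma degIn_singleton (e : G.edgeSet) (x : Fin n) :
    degIn G {e} x = if x ∈ e.val then 1 else 0 := by
  rw [degIn, filter_singleton]
  split_ifs <;> rfl

lemma degIn_insert {e : G.edgeSet} {J : Finset G.edgeSet} (he : e ∉ J) (x : Fin n) :
    degIn G (insert e J) x = (if x ∈ e.val then 1 else 0) + degIn G J x := by
  rw [degIn, filter_insert]
  split_ifs
  · rw [card_insert_of_notMem (by simp [he]), add_comm, degIn]
  · rw [zero_add, degIn]

/-- A path with an odd number of edges has a perfect matching. -/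
lemma exists_matching_of_isPath {u v : Fin n} : ∀ (p : G.Walk u v), p.IsPath → Odd p.length →
    ∃ J ⊆ walkEdges p, ∀ x, degIn G J x = if x ∈ p.support then 1 else 0
  | .nil, _, hodd => by simp at hodd
  | .cons h .nil, _, _ => by
    refine ⟨{⟨s(_, _), h⟩}, ?_, fun x => ?_⟩
    · simp [mem_walkEdges]
    · simp [degIn_singleton]
  | .cons (u := a) (v := b) h (.cons h' q), hp, hodd => by
    rw [SimpleGraph.Walk.cons_isPath_iff, SimpleGraph.Walk.cons_isPath_iff,
      SimpleGraph.Walk.support_cons, List.mem_cons, not_or] at hp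
    obtain ⟨⟨hq, hb⟩, -, ha⟩ := hp
    rw [SimpleGraph.Walk.length_cons, SimpleGraph.Walk.length_cons, add_assoc] at hodd
    replace hodd := (Nat.odd_add.1 hodd).2 even_two
    obtain ⟨J, hJ, hdeg⟩ := exists_matching_of_isPath q hq hodd
    refine ⟨insert ⟨s(_, _), h⟩ J, ?_, fun x => ?_⟩
    · intro e he
      rw [mem_insert] at he
      rw [mem_walkEdges, SimpleGraph.Walk.edges_cons, SimpleGraph.Walk.edges_cons]
      rcases he with rfl | he
      · simp
      · simp [mem_walkEdges.1 (hJ he)]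
    · rw [degIn_insert, hdeg, SimpleGraph.Walk.support_cons, SimpleGraph.Walk.support_cons]
      · simp only [Sym2.mem_iff, List.mem_cons]
        grind
      · intro he
        exact ha (q.fst_mem_support_of_mem_edges (mem_walkEdges.1 (hJ he)))

/-- An even cycle has a perfect matching. -/
lemma IsCycleSet.exists_matching {C : Finset G.edgeSet} (hC : IsCycleSet G C)
    (hcard : Even C.card) :
    ∃ J ⊆ C, ∀ x, degIn G J x = if x ∈ edgeVerts G C then 1 else 0 := by
  obtain ⟨v, w, hw, rfl⟩ := isCycleSet_iff.1 hC
  rw [card_walkEdges hw.isTrail] at hcard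
  simp only [edgeVerts_walkEdges hw.not_nil, List.mem_toFinset]
  cases w with
  | nil => exact absurd rfl hw.ne_nil
  | cons h p =>
    rw [SimpleGraph.Walk.length_cons, Nat.even_add_one, Nat.not_even_iff_odd] at hcard
    obtain ⟨J, hJ, hdeg⟩ :=
      exists_matching_of_isPath p (SimpleGraph.Walk.cons_isCycle_iff _ _ |>.1 hw).1 hcard
    refine ⟨J, fun e he => ?_, fun x => ?_⟩
    · rw [mem_walkEdges, SimpleGraph.Walk.edges_cons]
      exact List.mem_cons_of_mem _ (mem_walkEdges.1 (hJ he))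
    · rw [hdeg]
      refine if_congr ⟨List.mem_cons_of_mem _, fun hx => ?_⟩ rfl rfl
      rcases List.mem_cons.1 hx with rfl | hx
      exacts [p.end_mem_support, hx]

lemma IsCycleSet.isEvenChord {C : Finset G.edgeSet} (hC : IsCycleSet G C)
    (hG : G.Colorable 2) {l : G.edgeSet} (hl : IsChord G C l) : IsEvenChord G C l := by
  obtain ⟨hlC, hverts⟩ := hl
  obtain ⟨l, hl⟩ := l
  induction l with | _ u v
  obtain ⟨P, hPC, hP⟩ := hC.exists_subset_odd_degIn (G.ne_of_adj hl)
    (hverts u (Sym2.mem_mk_left u v)) (hverts v (Sym2.mem_mk_right u v))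
  set e : G.edgeSet := ⟨s(u, v), hl⟩ with he
  have h1 : IsEulerianSet G (P ∆ {e}) := by
    rw [isEulerianSet_iff]
    intro x
    rw [natCast_degIn_symmDiff, ← Nat.cast_add, ZMod.natCast_eq_zero_iff_even, Nat.even_add, hP,
      degIn_singleton]
    split_ifs with hx <;> rw [he, Sym2.mem_iff] at hx <;> simp <;> tauto
  have h2 : IsEulerianSet G (C ∆ (P ∆ {e})) := hC.isEulerianSet.symmDiff h1
  refine ⟨hlC, P ∆ {e}, C ∆ (P ∆ {e}), h1, h1.even_card_of_colorable hG, h2,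
    h2.even_card_of_colorable hG, ?_, ?_⟩
  · ext f
    have := @hPC f
    simp only [mem_inter, mem_symmDiff, mem_singleton]
    grind
  · rw [symmDiff_comm C, symmDiff_symmDiff_cancel_left]

lemma IsCycleSet.eq_of_subset {C D : Finset G.edgeSet} (hC : IsCycleSet G C)
    (hD : IsEulerianSet G D) (hDC : D ⊆ C) (hne : D.Nonempty) : D = C := by
  have hfull {e : G.edgeSet} (he : e ∈ C) {x : Fin n} (hx : x ∈ e.val)
      (hxD : x ∈ edgeVerts G D) : e ∈ D := by
    have h2 : 2 ≤ degIn G D x := by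
      obtain ⟨k, hk⟩ := hD x
      have := mem_edgeVerts_iff.1 hxD
      omega
    rw [← hC.degIn_eq_two (edgeVerts_mono hDC hxD)] at h2
    have h3 := eq_of_subset_of_card_le
      (filter_subset_filter (fun e : G.edgeSet => x ∈ e.val) hDC) h2
    exact (mem_filter.1 (h3 ▸ mem_filter.2 ⟨he, hx⟩)).1
  have hwalk {a b : Fin n} (p : G.Walk a b) (hp : walkEdges p ⊆ C)
      (ha : a ∈ edgeVerts G D) : b ∈ edgeVerts G D := by
    induction p with
    | nil => exact ha
    | cons h p ih =>
      refine ih (fun e he => hp ?_) ?_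
      · rw [mem_walkEdges] at *
        exact List.mem_cons_of_mem _ he
      · have he : (⟨s(_, _), h⟩ : G.edgeSet) ∈ D :=
          hfull (hp (by simp [mem_walkEdges])) (Sym2.mem_mk_left _ _) ha
        exact mem_filter.2 ⟨mem_univ _, _, he, Sym2.mem_mk_right _ _⟩
  have hpt {E : Finset G.edgeSet} {e : G.edgeSet} (he : e ∈ E) {x : Fin n} (hx : x ∈ e.val) :
      x ∈ edgeVerts G E := mem_filter.2 ⟨mem_univ _, e, he, hx⟩
  obtain ⟨v, w, hw, rfl⟩ := isCycleSet_iff.1 hC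
  have hverts : edgeVerts G (walkEdges w) = w.support.toFinset := edgeVerts_walkEdges hw.not_nil
  obtain ⟨e, he⟩ := hne
  have hv : v ∈ edgeVerts G D := by
    have hx := hpt (hDC he) e.val.out_fst_mem
    rw [hverts, List.mem_toFinset] at hx
    refine hwalk (w.takeUntil _ hx).reverse (fun f hf => ?_) (hpt he e.val.out_fst_mem)
    rw [mem_walkEdges, SimpleGraph.Walk.edges_reverse, List.mem_reverse] at hf
    exact mem_walkEdges.2 (SimpleGraph.Walk.edges_takeUntil_subset_edges _ hx hf)
  refine hDC.antisymm fun f hf => hfull hf f.val.out_fst_mem ?_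
  have hx := hpt hf f.val.out_fst_mem
  rw [hverts, List.mem_toFinset] at hx
  refine hwalk (w.takeUntil _ hx) (fun f hf => ?_) hv
  exact mem_walkEdges.2
    (SimpleGraph.Walk.edges_takeUntil_subset_edges _ hx (mem_walkEdges.1 hf))

lemma le_vdeg (a : G.edgeSet →₀ ℕ) {e : G.edgeSet} {i : Fin n} (hi : i ∈ e.val) :
    a e ≤ vdeg G a i := by
  conv_rhs => rw [← tsub_add_cancel_of_le (Finsupp.single_le_iff.2 (le_refl (a e)))]
  rw [map_add, Pi.add_apply, vdeg_single, if_pos hi]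
  exact le_add_self

/-- A perfect matching of a chordless cycle is determined by its class and one of its edges. -/
lemma IsCycleSet.eq_edgeInd_of_sameClass {C J : Finset G.edgeSet} (hC : IsCycleSet G C)
    (hch : ∀ l, ¬ IsChord G C l) (hJC : J ⊆ C)
    (hJ : ∀ x, degIn G J x = if x ∈ edgeVerts G C then 1 else 0) {a : G.edgeSet →₀ ℕ}
    (ha : SameClass G a (edgeInd J)) {e : G.edgeSet} (he : e ∈ J) (hae : a e ≠ 0) :
    a = edgeInd J := by
  have hle (i) : degIn G J i ≤ vdeg G a i := by
    have h := ha.2 i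
    rw [vdeg_edgeInd, hJ] at h
    rw [hJ]
    split_ifs at h ⊢
    · rw [Nat.one_le_iff_ne_zero]
      intro h0
      simp [h0] at h
    · exact Nat.zero_le _
  have hsum : ∑ i, degIn G J i = ∑ i, vdeg G a i := by
    rw [sum_univ_degIn, sum_vdeg, ha.1, degree_edgeInd]
  have heq (i) : degIn G J i = vdeg G a i :=
    (sum_eq_sum_iff_of_le fun i _ => hle i).1 hsum i (mem_univ i)
  have hone (f) : a f ≤ 1 := by
    refine (le_vdeg a f.val.out_fst_mem).trans ?_
    rw [← heq, hJ]
    split_ifs <;> simp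
  obtain ⟨L, rfl⟩ : ∃ L, a = edgeInd L := ⟨_, (edgeInd_support hone).symm⟩
  have hLC : L ⊆ C := by
    intro f hf
    by_contra hfC
    refine hch f ⟨hfC, fun i hi => ?_⟩
    have := le_vdeg (edgeInd L) hi
    rw [← heq, hJ, edgeInd_apply, if_pos hf] at this
    by_contra hiC
    simp [hiC] at this
  have heL : e ∈ L := by simpa [edgeInd_apply] using hae
  have hemp : L ∆ J = ∅ := by
    by_contra hne
    have h := hC.eq_of_subset (isEulerianSet_symmDiff_iff.2 ha.2)
      (symmDiff_le_sup.trans (union_subset hLC hJC)) (nonempty_iff_ne_empty.2 hne)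
    have : e ∈ L ∆ J := h ▸ hJC he
    simp [mem_symmDiff, he, heL] at this
  rw [symmDiff_eq_bot.1 hemp]

lemma exists_le_totalDegree_of_isCycleSet {K : Type*} [Field K]
    {S : Set (MvPolynomial G.edgeSet K)} (hS : Ideal.span S = eulerianIdeal K G)
    {C : Finset G.edgeSet} (hC : IsCycleSet G C) (hch : ∀ l, ¬ IsChord G C l) {d : ℕ}
    (hcard : C.card = 2 * d) : ∃ f ∈ S, d ≤ f.totalDegree := by
  by_contra! hlt
  obtain ⟨J, hJC, hJ⟩ := hC.exists_matching (hcard ▸ even_two_mul d)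
  have hJcard : J.card = d := by
    have h := sum_univ_degIn J
    simp only [hJ, sum_boole, filter_mem_eq_inter, univ_inter, Nat.cast_id, hC.card_edgeVerts,
      hcard] at h
    omega
  have hcompl : J ∆ (C \ J) = C := by
    rw [disjoint_sdiff.symmDiff_eq_sup, sup_eq_union, union_sdiff_of_subset hJC]
  have hcompl_card : (C \ J).card = d := by
    rw [card_sdiff_of_subset hJC]
    omega
  have hsame : SameClass G (edgeInd J) (edgeInd (C \ J)) :=
    ⟨by rw [degree_edgeInd, degree_edgeInd, hJcard, hcompl_card],
      isEulerianSet_symmDiff_iff.1 (hcompl.symm ▸ hC.isEulerianSet)⟩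
  have hmem := monomial_sub_mem_eulerianIdeal K hsame
  rw [← hS] at hmem
  have h0 : coeff (edgeInd J)
      (monomial (edgeInd J) (1 : K) - monomial (edgeInd (C \ J)) 1) = 0 := by
    refine coeff_eq_zero_of_mem_span (fun f hf => Ideal.subset_span hf)
      (fun f hf => ?_) (fun f hf b hb hne => ?_) hmem
    · rw [degree_edgeInd, hJcard]
      exact hlt f hf
    · rw [hS] at hf
      refine coeff_eq_zero_of_sameClass_unique K hf fun c hc => ?_
      obtain ⟨m, hm⟩ := exists_add_of_le hb
      have hm0 : m ≠ 0 := by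
        rintro rfl
        exact hne (by simpa using hm.symm)
      obtain ⟨e, he⟩ := Finsupp.ne_iff.1 hm0
      rw [Finsupp.zero_apply] at he
      have heJ : e ∈ J := by
        rw [← support_edgeInd J, hm, Finsupp.mem_support_iff, Finsupp.add_apply]
        omega
      have hcm : SameClass G (c + m) (edgeInd J) := hm ▸ sameClass_add_iff.2 hc
      have := hC.eq_edgeInd_of_sameClass hch hJC hJ hcm heJ
        (by rw [Finsupp.add_apply]; omega)
      exact add_right_cancel (this.trans hm)
  have hne : edgeInd (C \ J) ≠ edgeInd J := by
    intro h
    have h1 : C \ J = J := by rw [← support_edgeInd (C \ J), h, support_edgeInd]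
    rw [h1, symmDiff_self] at hcompl
    exact hC.nonempty.ne_empty hcompl.symm
  simp [coeff_monomial, hne] at h0

end LowerBound

/-- if `2d` is the greatest cardinality of an even cycle without an
even-chord, or of an edge-disjoint union of two odd cycles with at most one vertex in
common without an even-chord, then `d(I(G)) ≤ d`, with equality if `G` is bipartite. -/
theorem stmt10 {n : ℕ} (K : Type*) [Field K] (G : SimpleGraph (Fin n))
    (hE : 2 ≤ G.edgeSet.ncard) (d : ℕ)
    (hex : ∃ C : Finset G.edgeSet, SpecialSet G C ∧ C.card = 2 * d)
    (hmax : ∀ C : Finset G.edgeSet, SpecialSet G C → C.card ≤ 2 * d)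
    (S : Set (MvPolynomial G.edgeSet K))
    (hS : IsMinimalHomGenSet S (eulerianIdeal K G)) :
    sSup ((fun f : MvPolynomial G.edgeSet K => f.totalDegree) '' S) ≤ d ∧
      (G.Colorable 2 →
        sSup ((fun f : MvPolynomial G.edgeSet K => f.totalDegree) '' S) = d) := by
  obtain ⟨C, hC, hCd⟩ := hex
  have hd : 2 ≤ d := by
    have h3 : 3 ≤ C.card := by
      rcases hC.1 with ⟨h, -⟩ | ⟨C₁, C₂, h, -, -, -, -, -, rfl⟩
      · exact h.three_le_card
      · exact h.three_le_card.trans (card_le_card subset_union_left)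
    omega
  have hle : ∀ k ∈ (fun f : MvPolynomial G.edgeSet K => f.totalDegree) '' S, k ≤ d := by
    rintro _ ⟨f, hf, rfl⟩
    exact hS.totalDegree_le_of_specialSet hd hmax hf
  refine ⟨csSup_le' hle, fun hG => le_antisymm (csSup_le' hle) ?_⟩
  have hcyc : IsCycleSet G C := by
    rcases hC.1 with ⟨h, -⟩ | ⟨C₁, C₂, h, hodd, -⟩
    · exact h
    · exact absurd (h.isEulerianSet.even_card_of_colorable hG) (Nat.not_even_iff_odd.2 hodd)
  obtain ⟨f, hf, hdf⟩ := exists_le_totalDegree_of_isCycleSet hS.2.1 hcyc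
    (fun l hl => hC.2 ⟨l, hcyc.isEvenChord hG hl⟩) hCd
  exact hdf.trans (le_csSup ⟨d, hle⟩ ⟨f, hf, rfl⟩)
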